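/- arXiv:1807.00597 — 3 statements merged into one kernel-verified Lean document; each statement's English description precedes it below -/
import Mathlib

section
/- Let γ > 0 be a real number. Over all triples of nonnegative reals (x₁, x₂, x₃) with x₁ + x₂ + x₃ = 1 and x₃ = γ·x₂, the maximum value of Φ(x₁, x₂, x₃) is attained and equals 1 + (1+γ)/γ^{γ/(γ+1)}. -/
/-- `Φ(x₁, x₂, x₃) = 1/(x₁^x₁ x₂^x₂ x₃^x₃)` with real exponents (convention `0⁰ = 1`). -/
noncomputable def Phi3 (x₁ x₂ x₃ : ℝ) : ℝ :=
  1 / (x₁ ^ x₁ * x₂ ^ x₂ * x₃ ^ x₃)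

theorem Real.rpow_self_eq_exp_neg_negMulLog {x : ℝ} (hx : 0 ≤ x) :
    x ^ x = Real.exp (-Real.negMulLog x) := by
  rcases hx.eq_or_lt with rfl | hx
  · simp
  · rw [Real.rpow_def_of_pos hx, Real.negMulLog]
    ring_nf

theorem Phi3_eq_exp {x₁ x₂ x₃ : ℝ} (h₁ : 0 ≤ x₁) (h₂ : 0 ≤ x₂) (h₃ : 0 ≤ x₃) :
    Phi3 x₁ x₂ x₃ =
      Real.exp (Real.negMulLog x₁ + Real.negMulLog x₂ + Real.negMulLog x₃) := by
  rw [Phi3, Real.rpow_self_eq_exp_neg_negMulLog h₁, Real.rpow_self_eq_exp_neg_negMulLog h₂,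
    Real.rpow_self_eq_exp_neg_negMulLog h₃, ← Real.exp_add, ← Real.exp_add, one_div,
    ← Real.exp_neg]
  ring_nf

theorem Real.negMulLog_add_mul_log_le {x p : ℝ} (hx : 0 ≤ x) (hp : 0 < p) :
    Real.negMulLog x + x * Real.log p ≤ p - x := by
  rcases hx.eq_or_lt with rfl | hx
  · simpa using hp.le
  · have h := mul_le_mul_of_nonneg_left (Real.log_le_sub_one_of_pos (div_pos hp hx)) hx.le
    rw [Real.log_div hp.ne' hx.ne', mul_sub, mul_sub, mul_div_cancel₀ _ hx.ne'] at h
    rw [Real.negMulLog]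
    linarith

/-- The entropy of a pair in the ratio `1 : γ`, in terms of its total mass. -/
theorem Real.negMulLog_add_negMulLog_mul {γ : ℝ} (hγ : 0 < γ) (t : ℝ) :
    Real.negMulLog t + Real.negMulLog (γ * t) =
      Real.negMulLog ((1 + γ) * t) +
        (1 + γ) * t * Real.log ((1 + γ) / γ ^ (γ / (γ + 1))) := by
  rw [Real.log_div (by positivity) (by positivity), Real.log_rpow hγ, Real.negMulLog_mul,
    Real.negMulLog_mul]
  simp only [Real.negMulLog]
  field_simp
  ring

theorem Real.negMulLog_one_sub_add_le {C s : ℝ} (hC : 0 < C) (hs : 0 ≤ s) (hs' : s ≤ 1) :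
    Real.negMulLog (1 - s) + Real.negMulLog s + s * Real.log C ≤ Real.log (1 + C) := by
  have h₁ := Real.negMulLog_add_mul_log_le (sub_nonneg.2 hs')
    (show 0 < 1 / (1 + C) by positivity)
  have h₂ := Real.negMulLog_add_mul_log_le hs (show 0 < C / (1 + C) by positivity)
  rw [Real.log_div (by positivity) (by positivity)] at h₁ h₂
  have h : 1 / (1 + C) + C / (1 + C) = 1 := by field_simp
  rw [Real.log_one] at h₁
  linarith

theorem Real.negMulLog_one_sub_add_eq {C : ℝ} (hC : 0 < C) :
    Real.negMulLog (1 - C / (1 + C)) + Real.negMulLog (C / (1 + C)) +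
      C / (1 + C) * Real.log C = Real.log (1 + C) := by
  have h : 1 - C / (1 + C) = 1 / (1 + C) := by field_simp; ring
  rw [h]
  simp only [Real.negMulLog]
  rw [Real.log_div (by positivity) (by positivity), Real.log_div (by positivity) (by positivity),
    Real.log_one]
  field_simp
  ring

/-- Over all triples of nonnegative reals `(x₁, x₂, x₃)` with `x₁ + x₂ + x₃ = 1` and
`x₃ = γ·x₂`, the maximum of `Φ(x₁, x₂, x₃)` is attained and equals
`1 + (1+γ)/γ^(γ/(γ+1))`. -/
theorem phi3_max_on_line (γ : ℝ) (hγ : 0 < γ) :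
    ∃ x₁ x₂ x₃ : ℝ, 0 ≤ x₁ ∧ 0 ≤ x₂ ∧ 0 ≤ x₃ ∧ x₁ + x₂ + x₃ = 1 ∧ x₃ = γ * x₂ ∧
      Phi3 x₁ x₂ x₃ = 1 + (1 + γ) / γ ^ (γ / (γ + 1)) ∧
      ∀ y₁ y₂ y₃ : ℝ, 0 ≤ y₁ → 0 ≤ y₂ → 0 ≤ y₃ → y₁ + y₂ + y₃ = 1 → y₃ = γ * y₂ →
        Phi3 y₁ y₂ y₃ ≤ Phi3 x₁ x₂ x₃ := by
  have key := Real.negMulLog_add_negMulLog_mul hγ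
  have hC : 0 < (1 + γ) / γ ^ (γ / (γ + 1)) := by positivity
  set C := (1 + γ) / γ ^ (γ / (γ + 1))
  have hs : (1 + γ) * (C / (1 + C) / (1 + γ)) = C / (1 + C) := by field_simp
  have h₁ : 0 ≤ 1 - C / (1 + C) := by
    rw [sub_nonneg, div_le_one (by positivity)]
    linarith
  have hval : Phi3 (1 - C / (1 + C)) (C / (1 + C) / (1 + γ)) (γ * (C / (1 + C) / (1 + γ))) =
      1 + C := by
    rw [Phi3_eq_exp h₁ (by positivity) (by positivity), add_assoc, key, hs, ← add_assoc,
      Real.negMulLog_one_sub_add_eq hC, Real.exp_log (by positivity)]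
  refine ⟨_, _, _, h₁, by positivity, by positivity, by linarith, rfl, hval, ?_⟩
  rintro y₁ y₂ _ hy₁ hy₂ hy₃ hsum rfl
  rw [hval, Phi3_eq_exp hy₁ hy₂ hy₃, ← Real.le_log_iff_exp_le (by positivity), add_assoc, key,
    ← add_assoc, show y₁ = 1 - (1 + γ) * y₂ by linarith]
  exact Real.negMulLog_one_sub_add_le hC (by positivity) (by linarith)
end

section
/- Let γ > 0 be a real number, let ρ = γ^{γ/(1+γ)}/(1+γ) and x̃ = ρ/(1+ρ). Then the function f(x) = Φ(x, (1−x)/(1+γ), γ(1−x)/(1+γ)) on the interval [0,1] attains its maximum value at x = x̃, and f(x̃) = 1/x̃. -/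
open Real in
lemma Phi3_eq_exp_negMulLog {a b c : ℝ} (ha : 0 ≤ a) (hb : 0 ≤ b) (hc : 0 ≤ c) :
    Phi3 a b c = exp (negMulLog a + negMulLog b + negMulLog c) := by
  have key : ∀ {t : ℝ}, 0 ≤ t → t ^ t = exp (-negMulLog t) := by
    intro t ht
    rcases ht.eq_or_lt with rfl | ht
    · simp
    · rw [rpow_def_of_pos ht, negMulLog]
      ring_nf
  rw [Phi3, key ha, key hb, key hc, ← exp_add, ← exp_add, one_div, ← exp_neg]
  ring_nf

open Real in
/-- Grouping property of the entropy for the split of `1 - x` in proportion `1 : γ`. -/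
lemma negMulLog_split {γ : ℝ} (hγ : 0 < γ) (y : ℝ) :
    negMulLog (y / (1 + γ)) + negMulLog (γ * y / (1 + γ)) =
      negMulLog y - y * log (γ ^ (γ / (1 + γ)) / (1 + γ)) := by
  have h : 0 < 1 + γ := by positivity
  have h1 : negMulLog (1 + γ)⁻¹ = (1 + γ)⁻¹ * log (1 + γ) := by
    rw [negMulLog, log_inv]
    ring
  have h2 : y / (1 + γ) = y * (1 + γ)⁻¹ := rfl
  have h3 : γ * y / (1 + γ) = γ * (y * (1 + γ)⁻¹) := by ring
  rw [h3, h2, negMulLog_mul γ, negMulLog_mul y, h1, log_div (by positivity) h.ne', log_rpow hγ,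
    negMulLog, negMulLog]
  field_simp
  ring

open Real in
/-- One term of Gibbs' inequality. -/
lemma negMulLog_add_mul_log_le {x y : ℝ} (hx : 0 ≤ x) (hy : 0 < y) :
    negMulLog x + x * log y ≤ y - x := by
  rcases hx.eq_or_lt with rfl | hx
  · simpa using hy.le
  · have h := mul_le_mul_of_nonneg_left (log_le_sub_one_of_pos (div_pos hy hx)) hx.le
    rw [log_div hy.ne' hx.ne', mul_sub, mul_sub, mul_div_cancel₀ _ hx.ne'] at h
    rw [negMulLog]
    linarith

/-- For `γ > 0`, `ρ = γ^(γ/(1+γ))/(1+γ)` and `x̃ = ρ/(1+ρ)`, the function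
`f(x) = Φ(x, (1−x)/(1+γ), γ(1−x)/(1+γ))` on `[0,1]` attains its maximum at `x̃`,
and `f(x̃) = 1/x̃`. -/
theorem phi3_max_at (γ : ℝ) (hγ : 0 < γ)
    (ρ : ℝ) (hρ : ρ = γ ^ (γ / (1 + γ)) / (1 + γ))
    (x₀ : ℝ) (hx₀ : x₀ = ρ / (1 + ρ)) :
    x₀ ∈ Set.Icc (0 : ℝ) 1 ∧
    (∀ x ∈ Set.Icc (0 : ℝ) 1,
      Phi3 x ((1 - x) / (1 + γ)) (γ * (1 - x) / (1 + γ)) ≤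
        Phi3 x₀ ((1 - x₀) / (1 + γ)) (γ * (1 - x₀) / (1 + γ))) ∧
    Phi3 x₀ ((1 - x₀) / (1 + γ)) (γ * (1 - x₀) / (1 + γ)) = 1 / x₀ := by
  have hρ_pos : 0 < ρ := by rw [hρ]; positivity
  have hx₀_pos : 0 < x₀ := by rw [hx₀]; positivity
  have hsub : 1 - x₀ = 1 / (1 + ρ) := by rw [hx₀]; field_simp; ring
  have hsub_pos : 0 < 1 - x₀ := by rw [hsub]; positivity
  have hlog : Real.log ρ = Real.log x₀ - Real.log (1 - x₀) := by
    rw [← Real.log_div hx₀_pos.ne' hsub_pos.ne', hsub, hx₀]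
    congr 1
    field_simp
  have hPhi : ∀ x ∈ Set.Icc (0 : ℝ) 1,
      Phi3 x ((1 - x) / (1 + γ)) (γ * (1 - x) / (1 + γ)) =
        Real.exp (Real.negMulLog x + Real.negMulLog (1 - x) -
          (1 - x) * (Real.log x₀ - Real.log (1 - x₀))) := by
    rintro x ⟨hx, hx'⟩
    have hy : 0 ≤ 1 - x := sub_nonneg.2 hx'
    rw [Phi3_eq_exp_negMulLog hx (by positivity) (by positivity), add_assoc, negMulLog_split hγ,
      ← hρ, hlog, add_sub_assoc]
  have hmem : x₀ ∈ Set.Icc (0 : ℝ) 1 := ⟨hx₀_pos.le, by linarith⟩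
  have hmax : Phi3 x₀ ((1 - x₀) / (1 + γ)) (γ * (1 - x₀) / (1 + γ)) = 1 / x₀ := by
    rw [hPhi x₀ hmem, one_div, ← Real.exp_log (inv_pos.2 hx₀_pos), Real.log_inv,
      Real.negMulLog, Real.negMulLog]
    ring_nf
  refine ⟨hmem, fun x hx => ?_, hmax⟩
  rw [hmax, hPhi x hx, one_div, ← Real.exp_log (inv_pos.2 hx₀_pos), Real.log_inv, Real.exp_le_exp]
  have h1 := negMulLog_add_mul_log_le hx.1 hx₀_pos
  have h2 := negMulLog_add_mul_log_le (sub_nonneg.2 hx.2) hsub_pos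
  linarith
end

section
/- Let w be an infinite binary word that is Sturmian or periodic. Then the slope π(w) = lim_{n→∞} h(w₁⋯w_n)/n exists. -/
/-- An infinite binary word: every letter is `0` or `1`. -/
def IsBinaryWord (w : ℕ → ℕ) : Prop := ∀ i, w i ≤ 1

/-- The complexity function of `w`: the number of distinct factors (subwords) of
length `n`, a factor of length `n` being `w (i) w (i+1) ⋯ w (i+n-1)` for some `i`. -/
noncomputable def Complexity (w : ℕ → ℕ) (n : ℕ) : ℕ :=
  Set.ncard { f : Fin n → ℕ | ∃ i : ℕ, f = fun j : Fin n => w (i + j) }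

/-- `w` is Sturmian: `Comp_w(n) = n + 1` for all `n ≥ 1`. -/
noncomputable def IsSturmian (w : ℕ → ℕ) : Prop := ∀ n : ℕ, 1 ≤ n → Complexity w n = n + 1

/-- `w` is periodic with period `T ≥ 1`. -/
def IsPeriodicWord (w : ℕ → ℕ) (T : ℕ) : Prop := 1 ≤ T ∧ ∀ i, w (i + T) = w i

/-- The slope of `w` is `α`: the averages of the first `n` letters tend to `α`. -/
def HasSlope (w : ℕ → ℕ) (α : ℝ) : Prop :=
  Filter.Tendsto (fun n : ℕ => (∑ j ∈ Finset.range n, (w j : ℝ)) / n)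
    Filter.atTop (nhds α)

/-- The height of the factor of `w` of length `m` that starts at position `i`. -/
def factorHeight (w : ℕ → ℕ) (i m : ℕ) : ℕ := ∑ j ∈ Finset.range m, w (i + j)

/-- The factor of `w` of length `n` that starts at position `i`. -/
def factorAt (w : ℕ → ℕ) (n i : ℕ) : Fin n → ℕ := fun j => w (i + j)

lemma factorHeight_zero (w : ℕ → ℕ) (i : ℕ) : factorHeight w i 0 = 0 := rfl

lemma factorHeight_add (w : ℕ → ℕ) (i m k : ℕ) :
    factorHeight w i (m + k) = factorHeight w i m + factorHeight w (i + m) k := by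
  simp [factorHeight, Finset.sum_range_add, add_assoc]

lemma factorHeight_one (w : ℕ → ℕ) (i : ℕ) : factorHeight w i 1 = w i := by
  simp [factorHeight]

lemma factorHeight_succ (w : ℕ → ℕ) (i m : ℕ) :
    factorHeight w i (m + 1) = factorHeight w i m + w (i + m) := by
  rw [factorHeight_add, factorHeight_one]

lemma factorHeight_succ' (w : ℕ → ℕ) (i m : ℕ) :
    factorHeight w i (m + 1) = w i + factorHeight w (i + 1) m := by
  rw [add_comm m, factorHeight_add, factorHeight_one]

lemma IsBinaryWord.factorHeight_le {w : ℕ → ℕ} (hw : IsBinaryWord w) (i m : ℕ) :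
    factorHeight w i m ≤ m := by
  induction m with
  | zero => simp [factorHeight_zero]
  | succ m ih =>
    have := hw (i + m)
    rw [factorHeight_succ]
    omega

lemma factorAt_eq_iff {w : ℕ → ℕ} {n i k : ℕ} :
    factorAt w n i = factorAt w n k ↔ ∀ s < n, w (i + s) = w (k + s) :=
  ⟨fun h s hs => congrFun h ⟨s, hs⟩, fun h => funext fun s => h s s.2⟩

lemma complexity_eq_ncard_range (w : ℕ → ℕ) (n : ℕ) :
    Complexity w n = (Set.range (factorAt w n)).ncard := by
  unfold Complexity
  congr 1
  ext f
  exact ⟨fun ⟨i, h⟩ => ⟨i, h.symm⟩, fun ⟨i, h⟩ => ⟨i, h.symm⟩⟩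

lemma IsSturmian.ncard_range {w : ℕ → ℕ} (h : IsSturmian w) (n : ℕ) :
    (Set.range (factorAt w n)).ncard = n + 1 := by
  rcases Nat.eq_zero_or_pos n with rfl | hn
  · rw [zero_add, Set.ncard_eq_one]
    exact ⟨factorAt w 0 0, Set.eq_singleton_iff_unique_mem.2
      ⟨⟨0, rfl⟩, fun _ _ => Subsingleton.elim _ _⟩⟩
  · rw [← complexity_eq_ncard_range, h n hn]

lemma IsSturmian.finite_range {w : ℕ → ℕ} (h : IsSturmian w) (n : ℕ) :
    (Set.range (factorAt w n)).Finite :=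
  Set.finite_of_ncard_ne_zero (by rw [h.ncard_range]; omega)

lemma image_init_range_factorAt (w : ℕ → ℕ) (n : ℕ) :
    (fun f : Fin (n + 1) → ℕ => fun j : Fin n => f j.castSucc) ''
      Set.range (factorAt w (n + 1)) = Set.range (factorAt w n) := by
  rw [← Set.range_comp]
  rfl

/-- A Sturmian word has at least one right special factor of each length. -/
lemma IsSturmian.exists_right_special {w : ℕ → ℕ} (h : IsSturmian w) (n : ℕ) :
    ∃ i k, factorAt w n i = factorAt w n k ∧ w (i + n) ≠ w (k + n) := by
  by_contra! hc
  have hinj : Set.InjOn (fun f : Fin (n + 1) → ℕ => fun j : Fin n => f j.castSucc)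
      (Set.range (factorAt w (n + 1))) := by
    rintro _ ⟨i, rfl⟩ _ ⟨k, rfl⟩ hik
    have h1 : factorAt w n i = factorAt w n k := hik
    rw [factorAt_eq_iff] at h1 ⊢
    intro s hs
    rcases Nat.lt_succ_iff_lt_or_eq.1 hs with hs | rfl
    · exact h1 s hs
    · exact hc i k (factorAt_eq_iff.2 h1)
  have := hinj.ncard_image
  rw [image_init_range_factorAt, h.ncard_range, h.ncard_range] at this
  omega

/-- A Sturmian word has at most one right special factor of each length. -/
lemma IsSturmian.right_special_unique {w : ℕ → ℕ} (h : IsSturmian w) {n i k i' k' : ℕ}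
    (hik : factorAt w n i = factorAt w n k) (hne : w (i + n) ≠ w (k + n))
    (hik' : factorAt w n i' = factorAt w n k') (hne' : w (i' + n) ≠ w (k' + n)) :
    factorAt w n i = factorAt w n i' := by
  by_contra hc
  set A := Set.range (factorAt w (n + 1))
  set φ := fun f : Fin (n + 1) → ℕ => fun j : Fin n => f j.castSucc
  have hφw (m : ℕ) : φ (factorAt w (n + 1) m) = factorAt w n m := rfl
  have hlast {a b : ℕ} (hab : w (a + n) ≠ w (b + n)) :
      factorAt w (n + 1) a ≠ factorAt w (n + 1) b :=
    fun e => hab (factorAt_eq_iff.1 e n n.lt_succ_self)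
  have hinit {a b : ℕ} (hab : factorAt w n a ≠ factorAt w n b) :
      factorAt w (n + 1) a ≠ factorAt w (n + 1) b :=
    fun e => hab (by rw [← hφw, ← hφw, e])
  set B := (A \ {factorAt w (n + 1) i}) \ {factorAt w (n + 1) i'}
  have hBfin : B.Finite := ((h.finite_range (n + 1)).sdiff).sdiff
  have hsub : Set.range (factorAt w n) ⊆ φ '' B := by
    rintro _ ⟨m, rfl⟩
    by_cases h1 : factorAt w (n + 1) m = factorAt w (n + 1) i
    · refine ⟨factorAt w (n + 1) k, ⟨⟨⟨k, rfl⟩, (hlast hne).symm⟩, ?_⟩, ?_⟩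
      · exact hinit (hik ▸ hc)
      · rw [hφw, ← hik, ← hφw i, ← h1, hφw]
    by_cases h2 : factorAt w (n + 1) m = factorAt w (n + 1) i'
    · refine ⟨factorAt w (n + 1) k', ⟨⟨⟨k', rfl⟩, ?_⟩, (hlast hne').symm⟩, ?_⟩
      · exact hinit (hik' ▸ fun e => hc e.symm)
      · rw [hφw, ← hik', ← hφw i', ← h2, hφw]
    · exact ⟨_, ⟨⟨⟨m, rfl⟩, h1⟩, h2⟩, hφw m⟩
  have h1 := Set.ncard_le_ncard hsub (hBfin.image φ)
  have h2 := Set.ncard_image_le (f := φ) hBfin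
  have h3 : B.ncard + 1 = (A \ {factorAt w (n + 1) i}).ncard :=
    Set.ncard_sdiff_singleton_add_one ⟨⟨i', rfl⟩, (hinit hc).symm⟩
      (h.finite_range (n + 1)).sdiff
  have h4 : (A \ {factorAt w (n + 1) i}).ncard + 1 = A.ncard :=
    Set.ncard_sdiff_singleton_add_one ⟨i, rfl⟩ (h.finite_range (n + 1))
  have h5 := h.ncard_range n
  have h6 : A.ncard = n + 1 + 1 := h.ncard_range (n + 1)
  omega

/-- A Sturmian word is not eventually periodic. -/
lemma IsSturmian.not_eventually_periodic {w : ℕ → ℕ} (h : IsSturmian w) (M d : ℕ) (hd : 0 < d) :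
    ¬ ∀ m, M ≤ m → w (m + d) = w m := by
  intro hp
  have hsub : Set.range (factorAt w (M + d)) ⊆
      factorAt w (M + d) '' (Finset.range (M + d) : Set ℕ) := by
    rintro _ ⟨i, rfl⟩
    induction i using Nat.strong_induction_on with
    | _ i ih =>
      rcases lt_or_ge i (M + d) with hi | hi
      · exact ⟨i, by simpa using hi, rfl⟩
      · have : factorAt w (M + d) i = factorAt w (M + d) (i - d) := by
          rw [factorAt_eq_iff]
          intro s _
          rw [← hp (i - d + s) (by omega)]
          congr 1
          omega
        rw [this]
        exact ih _ (by omega)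
  have h1 := Set.ncard_le_ncard hsub ((Finset.finite_toSet _).image _)
  have h2 := Set.ncard_image_le (f := factorAt w (M + d))
    (Finset.finite_toSet (Finset.range (M + d)))
  rw [Set.ncard_coe_finset, Finset.card_range] at h2
  rw [h.ncard_range] at h1
  omega

/-- An unbalanced binary word has factors `0u0` and `1u1` with `u` a palindrome. -/
lemma IsBinaryWord.exists_palindrome_of_unbalanced {w : ℕ → ℕ} (hw : IsBinaryWord w)
    (hub : ∃ m i k, factorHeight w k m + 2 ≤ factorHeight w i m) :
    ∃ n p q, w p = 1 ∧ w (p + n + 1) = 1 ∧ w q = 0 ∧ w (q + n + 1) = 0 ∧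
      (∀ s, 1 ≤ s → s ≤ n → w (p + s) = w (q + s)) ∧
      ∀ s, 1 ≤ s → s ≤ n → w (p + s) = w (p + (n + 1 - s)) := by
  classical
  obtain ⟨p, q, hpq⟩ := Nat.find_spec hub
  have hmin : ∀ l < Nat.find hub, ∀ i k, factorHeight w i l ≤ factorHeight w k l + 1 := by
    intro l hl i k
    have := Nat.find_min hub hl
    push Not at this
    have := this i k
    omega
  generalize Nat.find hub = N at hpq hmin
  obtain ⟨n, rfl⟩ : ∃ n, N = n + 2 := by
    have := hw.factorHeight_le p N
    exact ⟨N - 2, by omega⟩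
  have hsplit (i l : ℕ) (hl : l ≤ n + 2) : factorHeight w i (n + 2) =
      factorHeight w i l + factorHeight w (i + l) (n + 2 - l) := by
    rw [← factorHeight_add]
    congr 1
    omega
  have hpre (l : ℕ) (h1 : 1 ≤ l) (h2 : l ≤ n + 1) :
      factorHeight w p l = factorHeight w q l + 1 := by
    have := hsplit p l (by omega)
    have := hsplit q l (by omega)
    have := hmin l (by omega) p q
    have := hmin (n + 2 - l) (by omega) (p + l) (q + l)
    omega
  have hsuf (l : ℕ) (h1 : 1 ≤ l) (h2 : l ≤ n + 1) :
      factorHeight w (p + (n + 2 - l)) l = factorHeight w p l := by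
    have e : n + 2 - (n + 2 - l) = l := by omega
    have a := hsplit p (n + 2 - l) (by omega)
    have b := hsplit q (n + 2 - l) (by omega)
    rw [e] at a b
    have := hpre (n + 2 - l) (by omega) (by omega)
    have := hpre l h1 h2
    have := hmin l (by omega) p (q + (n + 2 - l))
    have := hmin l (by omega) (p + (n + 2 - l)) q
    omega
  have hone := hpre 1 le_rfl (by omega)
  rw [factorHeight_one, factorHeight_one] at hone
  have hp1 := hw p
  have hlast := hpre (n + 1) (by omega) le_rfl
  have hp2 := factorHeight_succ w p (n + 1)
  have hq2 := factorHeight_succ w q (n + 1)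
  have hp3 := hw (p + (n + 1))
  simp only [add_assoc, Nat.reduceAdd] at hp2 hq2 hp3 ⊢
  refine ⟨n, p, q, by omega, by omega, by omega, by omega, ?_, ?_⟩
  · intro s hs1 hs2
    have := hpre s hs1 (by omega)
    have := hpre (s + 1) (by omega) (by omega)
    have := factorHeight_succ w p s
    have := factorHeight_succ w q s
    omega
  · intro s hs1 hs2
    have a := hsuf s hs1 (by omega)
    have b := hsuf (s + 1) (by omega) (by omega)
    have c := factorHeight_succ w p s
    have d := factorHeight_succ' w (p + (n + 1 - s)) s
    rw [show n + 2 - (s + 1) = n + 1 - s by omega] at b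
    rw [show p + (n + 1 - s) + 1 = p + (n + 2 - s) by omega] at d
    omega

/-- If `u` is a palindrome, `au` is the right special factor of its length, and `bub` is a factor
for a letter `b ≠ a`, then the word is eventually periodic. -/
lemma IsSturmian.false_of_palindrome {w : ℕ → ℕ} (h : IsSturmian w) {n p r k : ℕ}
    (hrp : w r ≠ w p) (hp : w (p + n + 1) = w p)
    (hpal : ∀ s, 1 ≤ s → s ≤ n → w (p + s) = w (p + (n + 1 - s)))
    (hmid : ∀ s, 1 ≤ s → s ≤ n → w (r + s) = w (p + s))
    (hrk : factorAt w (n + 1) r = factorAt w (n + 1) k)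
    (hne : w (r + (n + 1)) ≠ w (k + (n + 1))) : False := by
  have hdet {i j : ℕ} (hij : factorAt w (n + 1) i = factorAt w (n + 1) j)
      (hi : factorAt w (n + 1) i ≠ factorAt w (n + 1) r) :
      factorAt w (n + 1) (i + 1) = factorAt w (n + 1) (j + 1) := by
    have hnext : w (i + (n + 1)) = w (j + (n + 1)) := by
      by_contra hc
      exact hi (h.right_special_unique hij hc hrk hne)
    rw [factorAt_eq_iff] at hij ⊢
    intro s hs
    rw [add_assoc, add_assoc, add_comm 1 s]
    rcases Nat.lt_succ_iff_lt_or_eq.1 hs with hs | rfl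
    · exact hij (s + 1) (by omega)
    · exact hnext
  have hnot : ∀ t ≤ n + 1, factorAt w (n + 1) (p + t) ≠ factorAt w (n + 1) r := by
    intro t ht e
    rw [factorAt_eq_iff] at e
    have e0 := e 0 (by omega)
    simp only [add_zero] at e0
    rcases Nat.eq_zero_or_pos t with rfl | ht0
    · exact hrp e0.symm
    rcases Nat.lt_or_ge n t with htn | htn
    · obtain rfl : t = n + 1 := by omega
      exact hrp (by rw [← e0, ← hp, add_assoc])
    · have e1 := e (n + 1 - t) (by omega)
      rw [hmid _ (by omega) (by omega), ← hpal t ht0 htn,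
        show p + t + (n + 1 - t) = p + n + 1 by omega] at e1
      exact hrp (by rw [← e0, ← e1, hp])
  obtain ⟨i, j, hij, hj, heq⟩ : ∃ i j, i < j ∧ j ≤ n + 1 ∧
      factorAt w (n + 1) (p + i) = factorAt w (n + 1) (p + j) := by
    have hfin := h.finite_range (n + 1)
    have hcard : (Set.range (factorAt w (n + 1)) \ {factorAt w (n + 1) r}).ncard + 1
        = n + 1 + 1 := by
      rw [Set.ncard_sdiff_singleton_add_one (Set.mem_range_self r) hfin, h.ncard_range]
    obtain ⟨a, ha, b, hb, hab, e⟩ := Set.exists_ne_map_eq_of_ncard_lt_of_maps_to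
      (s := (Finset.range (n + 2) : Set ℕ))
      (t := Set.range (factorAt w (n + 1)) \ {factorAt w (n + 1) r})
      (f := fun t => factorAt w (n + 1) (p + t))
      (by rw [Set.ncard_coe_finset, Finset.card_range]; omega)
      (by
        intro t ht
        rw [Finset.coe_range, Set.mem_Iio] at ht
        exact ⟨⟨p + t, rfl⟩, hnot t (by omega)⟩)
      hfin.sdiff
    simp only [Finset.coe_range, Set.mem_Iio] at ha hb
    rcases lt_or_gt_of_ne hab with hlt | hlt
    · exact ⟨a, b, hlt, by omega, e⟩
    · exact ⟨b, a, hlt, by omega, e.symm⟩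
  have hper (l : ℕ) : factorAt w (n + 1) (p + i + l) = factorAt w (n + 1) (p + j + l) ∧
      ∀ m ≤ j + l, factorAt w (n + 1) (p + m) ≠ factorAt w (n + 1) r := by
    induction l with
    | zero => exact ⟨heq, fun m hm => hnot m (by omega)⟩
    | succ l ih =>
      obtain ⟨ih1, ih2⟩ := ih
      have hi := ih2 (i + l) (by omega)
      rw [← add_assoc] at hi
      have hstep : factorAt w (n + 1) (p + i + (l + 1)) = factorAt w (n + 1) (p + j + (l + 1)) :=
        hdet ih1 (hi : factorAt w (n + 1) (p + i + l) ≠ _)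
      refine ⟨hstep, fun m hm => ?_⟩
      rcases Nat.lt_or_ge (j + l) m with hlt | hle
      · obtain rfl : m = j + (l + 1) := by omega
        rw [← add_assoc, ← hstep, add_assoc]
        exact ih2 _ (by omega)
      · exact ih2 m hle
  refine h.not_eventually_periodic (p + i) (j - i) (by omega) fun m hm => ?_
  have := factorAt_eq_iff.1 (hper (m - (p + i))).1 0 (by omega)
  rw [show p + i + (m - (p + i)) + 0 = m by omega,
    show p + j + (m - (p + i)) + 0 = m + (j - i) by omega] at this
  exact this.symm

/-- Sturmian words are balanced. -/
lemma IsSturmian.balanced {w : ℕ → ℕ} (hw : IsBinaryWord w) (h : IsSturmian w) (m i k : ℕ) :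
    factorHeight w i m ≤ factorHeight w k m + 1 := by
  by_contra hc
  obtain ⟨n, p, q, hp, hp', hq, hq', hmid, hpal⟩ :=
    hw.exists_palindrome_of_unbalanced ⟨m, i, k, by omega⟩
  obtain ⟨r, k, hrk, hne⟩ := h.exists_right_special (n + 1)
  have hr : ∀ s, 1 ≤ s → s ≤ n → w (r + s) = w (p + s) := by
    have hu : factorAt w n (r + 1) = factorAt w n (p + 1) := by
      refine h.right_special_unique (k := k + 1) (k' := q + 1) ?_ ?_ ?_ ?_
      · rw [factorAt_eq_iff] at hrk ⊢
        intro s hs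
        simpa [add_assoc, add_comm 1] using hrk (s + 1) (by omega)
      · simpa [add_assoc, add_comm 1] using hne
      · rw [factorAt_eq_iff]
        intro s hs
        simpa [add_assoc, add_comm 1] using hmid (s + 1) (by omega) (by omega)
      · rw [add_right_comm, hp', add_right_comm, hq']
        exact one_ne_zero
    intro s hs1 hs2
    have := factorAt_eq_iff.1 hu (s - 1) (by omega)
    rwa [show r + 1 + (s - 1) = r + s by omega, show p + 1 + (s - 1) = p + s by omega] at this
  have hr1 := hw r
  rcases Nat.eq_zero_or_pos (w r) with h0 | h0
  · exact h.false_of_palindrome (p := p) (by omega) (by omega) hpal hr hrk hne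
  · refine h.false_of_palindrome (p := q) (by omega) (by omega) ?_ ?_ hrk hne
    · intro s hs1 hs2
      rw [← hmid s hs1 hs2, ← hmid _ (by omega) (by omega), hpal s hs1 hs2]
    · intro s hs1 hs2
      rw [hr s hs1 hs2, hmid s hs1 hs2]

lemma IsPeriodicWord.factorHeight_le {w : ℕ → ℕ} (hw : IsBinaryWord w) {T : ℕ}
    (h : IsPeriodicWord w T) (m i : ℕ) :
    factorHeight w i m ≤ factorHeight w 0 m + T := by
  induction i using Nat.strong_induction_on with
  | _ i ih =>
    have hT := h.1
    rcases lt_or_ge i T with hi | hi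
    · have h1 := factorHeight_add w 0 i m
      have h2 := factorHeight_add w 0 m i
      have h3 := hw.factorHeight_le (0 + m) i
      rw [add_comm i m] at h1
      rw [zero_add] at h1
      omega
    · have e : factorHeight w i m = factorHeight w (i - T) m := by
        refine Finset.sum_congr rfl fun j _ => ?_
        rw [← h.2 (i - T + j)]
        congr 1
        omega
      rw [e]
      exact ih _ (by omega)

/-- The slope exists as soon as the height of every factor exceeds the height of the prefix of the
same length by at most a constant. -/
lemma exists_hasSlope_of_factorHeight_le {w : ℕ → ℕ} {C : ℕ}
    (h : ∀ m i, factorHeight w i m ≤ factorHeight w 0 m + C) : ∃ α : ℝ, HasSlope w α := by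
  have hsub : Subadditive fun n => (factorHeight w 0 n : ℝ) + C := by
    intro m n
    have h1 := factorHeight_add w 0 m n
    have h2 := h n (0 + m)
    have h3 : factorHeight w 0 (m + n) + C ≤ factorHeight w 0 m + C + (factorHeight w 0 n + C) := by
      omega
    dsimp only
    exact_mod_cast h3
  have hbdd : BddBelow (Set.range fun n : ℕ => ((factorHeight w 0 n : ℝ) + C) / n) :=
    ⟨0, by rintro _ ⟨n, rfl⟩; positivity⟩
  refine ⟨hsub.lim, ?_⟩
  have := (hsub.tendsto_lim hbdd).sub (tendsto_const_div_atTop_nhds_zero_nat (C : ℝ))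
  rw [sub_zero] at this
  refine this.congr fun n => ?_
  rw [← sub_div, add_sub_cancel_right]
  simp [factorHeight]

/-- If `w` is Sturmian or periodic, then the slope `π(w)` exists. -/
theorem slope_exists (w : ℕ → ℕ) (hw : IsBinaryWord w)
    (h : IsSturmian w ∨ ∃ T, IsPeriodicWord w T) :
    ∃ α : ℝ, HasSlope w α := by
  rcases h with h | ⟨T, h⟩
  · exact exists_hasSlope_of_factorHeight_le fun m i => h.balanced hw m i 0
  · exact exists_hasSlope_of_factorHeight_le fun m i => h.factorHeight_le hw m i
end
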